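/- arXiv:2301.04620 — 5 statements merged into one kernel-verified Lean document; each statement's English description precedes it below -/
import Mathlib

section
/- Let V be a finite set, s a positive integer with s ≤ |V|, and f : Finset V → ℝ a set function with f(∅) = 0 that is nonnegative (f(S) ≥ 0 for all S ⊆ V) and monotone (S ⊆ T implies f(S) ≤ f(T)). Let γ ∈ (0, 1] be such that for all L, S ⊆ V with |S| ≤ s and all x ∈ V \ (S ∪ L), f(L ∪ {x}) − f(L) ≥ γ · (f(L ∪ S ∪ {x}) − f(L ∪ S)). Let S# = {x₁, …, x_s} be produced by the greedy algorithm: writing S_i = {x₁, …, x_i} (S₀ = ∅), each x_{i+1} is chosen in V \ S_i to maximize f(S_i ∪ {x}) − f(S_i) over x ∈ V \ S_i. Then f(S#) ≥ (1 − exp(−γ)) · max{ f(S) : S ⊆ V, |S| = s }. -/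
/-- Greedy approximation guarantee for set functions with submodularity ratio at least `γ`
(Theorem 1 of the paper). -/
theorem greedy_submodularity_ratio_guarantee
    (V : Type*) [Fintype V] [DecidableEq V]
    (f : Finset V → ℝ) (s : ℕ) (hs : 0 < s) (hsV : s ≤ Fintype.card V)
    (hf0 : f ∅ = 0)
    (hfnonneg : ∀ S : Finset V, 0 ≤ f S)
    (hfmono : ∀ S T : Finset V, S ⊆ T → f S ≤ f T)
    (γ : ℝ) (hγ0 : 0 < γ) (hγ1 : γ ≤ 1)
    (hratio : ∀ L S : Finset V, S.card ≤ s → ∀ x : V, x ∉ S ∪ L →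
      γ * (f (L ∪ S ∪ {x}) - f (L ∪ S)) ≤ f (L ∪ {x}) - f L)
    -- the greedy algorithm: `Sg i` is the set after `i` iterations, `x i` the element
    -- added at iteration `i+1`
    (x : Fin s → V) (Sg : ℕ → Finset V)
    (hSg0 : Sg 0 = ∅)
    (hSgsucc : ∀ i : Fin s, Sg ((i : ℕ) + 1) = Sg (i : ℕ) ∪ {x i})
    (hxnew : ∀ i : Fin s, x i ∉ Sg (i : ℕ))
    (hgreedy : ∀ i : Fin s, ∀ y : V, y ∉ Sg (i : ℕ) →
      f (Sg (i : ℕ) ∪ {y}) - f (Sg (i : ℕ)) ≤ f (Sg (i : ℕ) ∪ {x i}) - f (Sg (i : ℕ))) :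
    ∀ S : Finset V, S.card = s → (1 - Real.exp (-γ)) * f S ≤ f (Sg s) := by
  intro S hS
  have hsR : (0 : ℝ) < s := by exact_mod_cast hs
  have hs1 : (1 : ℝ) ≤ s := by exact_mod_cast hs
  have step : ∀ i : Fin s, γ * (f S - f (Sg i)) ≤ s * (f (Sg ((i : ℕ) + 1)) - f (Sg i)) := by
    intro i
    rw [hSgsucc i]
    have hδ : 0 ≤ f (Sg (i : ℕ) ∪ {x i}) - f (Sg (i : ℕ)) :=
      sub_nonneg.2 (hfmono _ _ Finset.subset_union_left)
    have key : ∀ T : Finset V, T.card ≤ s → γ * (f (Sg (i : ℕ) ∪ T) - f (Sg (i : ℕ))) ≤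
        T.card * (f (Sg (i : ℕ) ∪ {x i}) - f (Sg (i : ℕ))) := by
      intro T
      induction T using Finset.induction_on with
      | empty => simp
      | insert a T ha ih =>
        intro hc
        rw [Finset.card_insert_of_notMem ha] at hc ⊢
        have ih' := ih (by omega)
        push_cast
        by_cases haL : a ∈ Sg (i : ℕ)
        · have e : Sg (i : ℕ) ∪ insert a T = Sg (i : ℕ) ∪ T := by
            ext z
            simp only [Finset.mem_union, Finset.mem_insert]
            grind
          rw [e]
          linarith
        · have e : Sg (i : ℕ) ∪ insert a T = Sg (i : ℕ) ∪ T ∪ {a} := by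
            ext z
            simp only [Finset.mem_union, Finset.mem_insert, Finset.mem_singleton]
            tauto
          rw [e]
          have h1 := hratio (Sg (i : ℕ)) T (by omega) a (by simp [ha, haL])
          have h2 := hgreedy i a haL
          linarith
    have h := key S hS.le
    rw [hS] at h
    have hm := mul_le_mul_of_nonneg_left
      (hfmono S (Sg (i : ℕ) ∪ S) Finset.subset_union_right) hγ0.le
    linarith
  have hq : 0 ≤ 1 - γ / s := by
    rw [sub_nonneg, div_le_one hsR]
    linarith
  have main : ∀ n : ℕ, n ≤ s → f S - f (Sg n) ≤ (1 - γ / s) ^ n * f S := by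
    intro n
    induction n with
    | zero => simp [hSg0, hf0]
    | succ n ih =>
      intro hn
      have h1 := step ⟨n, by omega⟩
      have h2 := mul_le_mul_of_nonneg_left (ih (by omega)) hq
      simp only at h1
      have h3 : γ / s * (f S - f (Sg n)) ≤ f (Sg (n + 1)) - f (Sg n) := by
        rw [div_mul_eq_mul_div, div_le_iff₀ hsR]
        linarith
      rw [pow_succ]
      linarith
  have h := main s le_rfl
  have he : (1 - γ / s) ^ s ≤ Real.exp (-γ) := Real.one_sub_div_pow_le_exp_neg (by linarith)
  have := mul_le_mul_of_nonneg_right he (hfnonneg S)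
  linarith
end

section
/- Let N ≥ 2 and d ≥ 1. Let W be a symmetric matrix of nonnegative edge weights on node set {0, 1, …, N−1} (with W i i = 0), and let L be the weighted Laplacian of W and L̃ its reduced Laplacian. Let 𝓘 be a symmetric d × d real matrix, and let p : {0, …, N−1} → ℝ^d be pose-error vectors with p 0 = 0. Let w̃ ∈ ℝ^{(N−1)d} be the stacking of p 1, …, p (N−1). Then ∑_{0 ≤ i < j ≤ N−1} W i j · (p i − p j)ᵀ 𝓘 (p i − p j) = w̃ᵀ (L̃ ⊗ 𝓘) w̃, where ⊗ denotes the Kronecker product. -/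
open Matrix

theorem gpg_half_sum {N : ℕ} (f : Fin N → Fin N → ℝ) (hs : ∀ i j, f i j = f j i)
    (hd : ∀ i, f i i = 0) :
    2 * (∑ i, ∑ j, if i < j then f i j else 0) = ∑ i, ∑ j, f i j := by
  have h1 : (∑ i, ∑ j, if i < j then f i j else 0) = ∑ i, ∑ j, if j < i then f i j else 0 := by
    rw [Finset.sum_comm]
    refine Finset.sum_congr rfl fun i _ => Finset.sum_congr rfl fun j _ => ?_
    rw [hs]
  rw [two_mul]
  nth_rewrite 2 [h1]
  simp only [← Finset.sum_add_distrib]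
  refine Finset.sum_congr rfl fun i _ => Finset.sum_congr rfl fun j _ => ?_
  rcases lt_trichotomy i j with h | h | h
  · simp [h, h.not_gt]
  · subst h; simp [hd]
  · simp [h, h.not_gt]

theorem gpg_lap {N : ℕ} (W B : Fin N → Fin N → ℝ) (hW : ∀ i j, W i j = W j i)
    (hd : ∀ i, W i i = 0) (hB : ∀ i j, B i j = B j i) :
    (∑ i, ∑ j, if i < j then W i j * (B i i + B j j - 2 * B i j) else 0)
      = ∑ i, ∑ j, (if i = j then ∑ m ∈ Finset.univ.erase i, W i m else -W i j) * B i j := by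
  have h1 := gpg_half_sum (fun i j => W i j * (B i i + B j j - 2 * B i j))
    (fun i j => by simp only [hW i j, hB i j]; ring) (fun i => by simp [hd])
  have h2 : ∀ i j, (if i = j then ∑ m ∈ Finset.univ.erase i, W i m else -W i j) * B i j
      = (if i = j then (∑ m, W i m) * B i j else 0) - W i j * B i j := by
    intro i j
    by_cases h : i = j
    · subst h
      have := Finset.add_sum_erase Finset.univ (fun m => W i m) (Finset.mem_univ i)
      simp only [hd, zero_add] at this
      simp [hd, this]
    · simp [h]
  have h3 : ∑ i, ∑ j, W i j * B j j = ∑ i, ∑ j, W i j * B i i := by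
    rw [Finset.sum_comm]
    refine Finset.sum_congr rfl fun i _ => Finset.sum_congr rfl fun j _ => ?_
    rw [hW]
  have h4 : ∑ i, ∑ j, W i j * (B i i + B j j - 2 * B i j)
      = ∑ i, ∑ j, W i j * B i i + ∑ i, ∑ j, W i j * B j j - 2 * ∑ i, ∑ j, W i j * B i j := by
    simp only [Finset.mul_sum, ← Finset.sum_add_distrib, ← Finset.sum_sub_distrib]
    refine Finset.sum_congr rfl fun i _ => Finset.sum_congr rfl fun j _ => ?_
    ring
  simp only [h2, Finset.sum_sub_distrib, Finset.sum_ite_eq, Finset.mem_univ, if_true,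
    Finset.sum_mul]
  linarith

/-- Uncertainty quantification for the global pose graph (Lemma 1): anchoring the first
keyframe, the quadratic term of the map-optimization objective equals the quadratic form of
the information matrix `L̃ ⊗ 𝓘`, where `L̃` is the reduced weighted Laplacian. -/
theorem global_pose_graph_information_matrix
    (N d : ℕ) (hN : 2 ≤ N) (hd : 1 ≤ d)
    (W : Matrix (Fin N) (Fin N) ℝ)
    (hWsymm : W.IsSymm) (hWnonneg : ∀ i j, 0 ≤ W i j) (hWdiag : ∀ i, W i i = 0)
    (I : Matrix (Fin d) (Fin d) ℝ) (hI : I.IsSymm)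
    (p : Fin N → Fin d → ℝ) (hp0 : p ⟨0, by omega⟩ = 0) :
    -- the weighted Laplacian
    let L : Matrix (Fin N) (Fin N) ℝ :=
      Matrix.of fun i j => if i = j then ∑ m ∈ Finset.univ.erase i, W i m else -W i j
    -- the reduced Laplacian (row and column of node 0 deleted)
    let Lred : Matrix (Fin (N - 1)) (Fin (N - 1)) ℝ :=
      Matrix.of fun i j =>
        L ⟨(i : ℕ) + 1, by have := i.isLt; omega⟩ ⟨(j : ℕ) + 1, by have := j.isLt; omega⟩
    -- the stacked pose-error vector of `p 1, …, p (N-1)`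
    let wt : Fin (N - 1) × Fin d → ℝ := fun q =>
      p ⟨(q.1 : ℕ) + 1, by have := q.1.isLt; omega⟩ q.2
    (∑ i : Fin N, ∑ j : Fin N,
        if i < j then W i j * ((p i - p j) ⬝ᵥ (I *ᵥ (p i - p j))) else 0)
      = wt ⬝ᵥ ((Matrix.kroneckerMap (· * ·) Lred I) *ᵥ wt) := by
  intro L Lred wt
  obtain ⟨n, rfl⟩ : ∃ n, N = n + 1 := ⟨N - 1, by omega⟩
  have hp0' : p 0 = 0 := hp0
  have hB : ∀ i j, p i ⬝ᵥ (I *ᵥ p j) = p j ⬝ᵥ (I *ᵥ p i) := by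
    intro i j
    rw [Matrix.dotProduct_mulVec, ← Matrix.mulVec_transpose, hI.eq, dotProduct_comm]
  have key := gpg_lap W (fun i j => p i ⬝ᵥ (I *ᵥ p j)) (fun i j => hWsymm.apply j i) hWdiag hB
  have hQ : ∀ i j, (p i - p j) ⬝ᵥ (I *ᵥ (p i - p j))
      = p i ⬝ᵥ (I *ᵥ p i) + p j ⬝ᵥ (I *ᵥ p j) - 2 * (p i ⬝ᵥ (I *ᵥ p j)) := by
    intro i j
    rw [Matrix.mulVec_sub, sub_dotProduct, dotProduct_sub, dotProduct_sub, hB j i]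
    ring
  simp only [hQ]
  refine key.trans ?_
  have hR : wt ⬝ᵥ ((Matrix.kroneckerMap (· * ·) Lred I) *ᵥ wt)
      = ∑ i : Fin n, ∑ j : Fin n, L i.succ j.succ * (p i.succ ⬝ᵥ (I *ᵥ p j.succ)) := by
    change ∑ q : Fin n × Fin d, p q.1.succ q.2 * ∑ r : Fin n × Fin d,
      (L q.1.succ r.1.succ * I q.2 r.2) * p r.1.succ r.2 = _
    simp only [Fintype.sum_prod_type, dotProduct, Matrix.mulVec, Finset.mul_sum]
    refine Finset.sum_congr rfl fun i _ => ?_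
    rw [Finset.sum_comm]
    refine Finset.sum_congr rfl fun j _ => Finset.sum_congr rfl fun a _ =>
      Finset.sum_congr rfl fun b _ => ?_
    ring
  rw [hR]
  change ∑ i, ∑ j, L i j * (p i ⬝ᵥ (I *ᵥ p j)) = _
  rw [Fin.sum_univ_succ]
  simp [Fin.sum_univ_succ (n := n), hp0']
end

section
/- Let N ≥ 2, M ≥ 0 and d ≥ 1. Let W be a symmetric matrix of nonnegative edge weights on the local node set {0, 1, …, N−1} (with W i i = 0), and let U : {0, …, N−1} × {0, …, M−1} → ℝ≥0 give nonnegative edge weights between local nodes and fixed nodes. Define the grounded Laplacian L_loc as the N × N matrix with (L_loc) i j = −W i j for i ≠ j and (L_loc) i i = ∑_{j≠i} W i j + ∑_{m} U i m, and let L̃_loc be obtained from L_loc by deleting the row and column of node 0. Let 𝓘 be a symmetric d × d real matrix, and let p : {0, …, N−1} → ℝ^d with p 0 = 0 (the fixed nodes have zero pose error). Let w̃ ∈ ℝ^{(N−1)d} be the stacking of p 1, …, p (N−1). Then ∑_{0 ≤ i < j ≤ N−1} W i j · (p i − p j)ᵀ 𝓘 (p i − p j) + ∑_{i=0}^{N−1}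 ∑_{m=0}^{M−1} U i m · (p i)ᵀ 𝓘 (p i) = w̃ᵀ (L̃_loc ⊗ 𝓘) w̃. -/
open Matrix

theorem aux_lap (n M : ℕ) (W B : Fin n → Fin n → ℝ) (U : Fin n → Fin M → ℝ)
    (hW : ∀ i j, W j i = W i j) (hd : ∀ i, W i i = 0) :
    (∑ i, ∑ j, if i < j then W i j * (B i i - B i j - B j i + B j j) else 0)
      + (∑ i, ∑ m, U i m * B i i)
    = ∑ i, ∑ j, (if i = j then (∑ m ∈ Finset.univ.erase i, W i m) + ∑ m : Fin M, U i m
        else -W i j) * B i j := by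
  have h1 : (∑ i, ∑ j, if i < j then W i j * (B i i - B i j - B j i + B j j) else 0)
      = ∑ i, ∑ j, W i j * (B i i - B i j) := by
    have e1 : (∑ i, ∑ j, if i < j then W i j * (B i i - B i j - B j i + B j j) else 0)
      = (∑ i, ∑ j, if i < j then W i j * (B i i - B i j) else 0)
        + ∑ i, ∑ j, if i < j then W j i * (B j j - B j i) else 0 := by
      simp only [← Finset.sum_add_distrib]
      refine Finset.sum_congr rfl fun i _ => Finset.sum_congr rfl fun j _ => ?_
      rw [hW i j]
      split_ifs <;> ring
    rw [e1, Finset.sum_comm (f := fun i j => if i < j then W j i * (B j j - B j i) else 0)]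
    simp only [← Finset.sum_add_distrib]
    refine Finset.sum_congr rfl fun i _ => Finset.sum_congr rfl fun j _ => ?_
    rcases lt_trichotomy i j with h | h | h
    · simp [h, h.not_gt]
    · subst h; simp
    · simp [h, h.not_gt]
  rw [h1, ← Finset.sum_add_distrib]
  refine Finset.sum_congr rfl fun i _ => ?_
  have h2 : ∀ j, (if i = j then (∑ m ∈ Finset.univ.erase i, W i m) + ∑ m : Fin M, U i m
        else -W i j) * B i j
      = (if i = j then ((∑ m, W i m) + ∑ m : Fin M, U i m) * B i j else 0) - W i j * B i j := by
    intro j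
    split_ifs with h
    · subst h
      rw [Finset.sum_erase _ (hd i), hd i]; ring
    · ring
  simp only [h2, Finset.sum_sub_distrib, mul_sub, ← Finset.sum_mul, Finset.sum_ite_eq,
    Finset.mem_univ, if_true]
  ring

/-- Uncertainty quantification for the local pose graph (Lemma 2): with the first local
keyframe anchored and fixed keyframes treated as zero-error constants, the quadratic term of
the local map-optimization objective equals the quadratic form of the information matrix
`L̃_loc ⊗ 𝓘`, where `L̃_loc` is the reduced grounded Laplacian. -/
theorem local_pose_graph_information_matrix
    (N M d : ℕ) (hN : 2 ≤ N) (hd : 1 ≤ d)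
    (W : Matrix (Fin N) (Fin N) ℝ)
    (hWsymm : W.IsSymm) (hWnonneg : ∀ i j, 0 ≤ W i j) (hWdiag : ∀ i, W i i = 0)
    (U : Fin N → Fin M → ℝ) (hUnonneg : ∀ i m, 0 ≤ U i m)
    (I : Matrix (Fin d) (Fin d) ℝ) (hI : I.IsSymm)
    (p : Fin N → Fin d → ℝ) (hp0 : p ⟨0, by omega⟩ = 0) :
    -- the grounded Laplacian
    let Lloc : Matrix (Fin N) (Fin N) ℝ :=
      Matrix.of fun i j =>
        if i = j then (∑ m ∈ Finset.univ.erase i, W i m) + ∑ m : Fin M, U i m else -W i j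
    -- the reduced grounded Laplacian (row and column of node 0 deleted)
    let Lred : Matrix (Fin (N - 1)) (Fin (N - 1)) ℝ :=
      Matrix.of fun i j =>
        Lloc ⟨(i : ℕ) + 1, by have := i.isLt; omega⟩ ⟨(j : ℕ) + 1, by have := j.isLt; omega⟩
    -- the stacked pose-error vector of `p 1, …, p (N-1)`
    let wt : Fin (N - 1) × Fin d → ℝ := fun q =>
      p ⟨(q.1 : ℕ) + 1, by have := q.1.isLt; omega⟩ q.2
    (∑ i : Fin N, ∑ j : Fin N,
        if i < j then W i j * ((p i - p j) ⬝ᵥ (I *ᵥ (p i - p j))) else 0)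
      + (∑ i : Fin N, ∑ m : Fin M, U i m * (p i ⬝ᵥ (I *ᵥ p i)))
      = wt ⬝ᵥ ((Matrix.kroneckerMap (· * ·) Lred I) *ᵥ wt) := by
  intro Lloc Lred wt
  obtain ⟨n, rfl⟩ : ∃ n, N = n + 1 := ⟨N - 1, by omega⟩
  have hp : p 0 = 0 := hp0
  have key := aux_lap (n + 1) M W (fun i j => p i ⬝ᵥ (I *ᵥ p j)) U
    (fun i j => hWsymm.apply i j) hWdiag
  have hexp : ∀ i j, (p i - p j) ⬝ᵥ (I *ᵥ (p i - p j))
      = p i ⬝ᵥ (I *ᵥ p i) - p i ⬝ᵥ (I *ᵥ p j) - p j ⬝ᵥ (I *ᵥ p i) + p j ⬝ᵥ (I *ᵥ p j) := by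
    intro i j
    rw [Matrix.mulVec_sub, sub_dotProduct, dotProduct_sub, dotProduct_sub]
    ring
  simp only [hexp]
  refine key.trans ?_
  change ∑ i, ∑ j, Lloc i j * (p i ⬝ᵥ (I *ᵥ p j)) = _
  have hR : wt ⬝ᵥ ((Matrix.kroneckerMap (· * ·) Lred I) *ᵥ wt)
      = ∑ i : Fin n, ∑ j : Fin n, Lloc i.succ j.succ * (p i.succ ⬝ᵥ (I *ᵥ p j.succ)) := by
    change ∑ q : Fin n × Fin d, p q.1.succ q.2 * ∑ r : Fin n × Fin d,
      (Lloc q.1.succ r.1.succ * I q.2 r.2) * p r.1.succ r.2 = _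
    simp only [Fintype.sum_prod_type, dotProduct, Matrix.mulVec, Finset.mul_sum]
    refine Finset.sum_congr rfl fun i _ => ?_
    rw [Finset.sum_comm]
    refine Finset.sum_congr rfl fun j _ => Finset.sum_congr rfl fun a _ =>
      Finset.sum_congr rfl fun b _ => ?_
    ring
  rw [hR]
  simp [Fin.sum_univ_succ (n := n), hp]
end

section
/- Let N ≥ 2 and let W be a symmetric matrix of edge weights on the local node set {0, 1, …, N−1} with W i j ≥ 1 for all i ≠ j and W i i = 0. Let F be a finite set (of candidate fixed keyframes) and U : {0, …, N−1} × F → ℝ≥0 nonnegative weights. For S ⊆ F define the grounded Laplacian L(S) as the N × N matrix with (L(S)) i j = −W i j for i ≠ j and (L(S)) i i = ∑_{j≠i} W i j + ∑_{m ∈ S} U i m, and let L̃(S) be obtained by deleting the row and column of node 0. Then the set function f(S) = log det L̃(S) is (i) nonnegative: f(S) ≥ 0 for all S ⊆ F; (ii) monotone: S ⊆ T implies f(S) ≤ f(T); and (iii) submodular: f(L) + f(S) ≥ f(L ∪ S) + f(L ∩ S) for all L, S ⊆ F. -/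
open Matrix in
lemma kf_det_add_single {n : Type*} [Fintype n] [DecidableEq n] {A : Matrix n n ℝ}
    (hA : A.PosDef) (i : n) (x : ℝ) :
    (A + Matrix.single i i x).det = A.det * (1 + x * A⁻¹ i i) := by
  have h : Matrix.single i i x
      = replicateCol Unit (Pi.single i x) * replicateRow Unit (Pi.single i (1 : ℝ)) := by
    ext a b
    simp [Matrix.single, Matrix.mul_apply, Pi.single_apply]
    aesop
  rw [h, det_add_replicateCol_mul_replicateRow hA.det_pos.ne'.isUnit]
  congr 1
  simp [Matrix.det_unique, Matrix.mul_apply, Pi.single_apply, mul_comm]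

open Matrix in
lemma kf_inv_antitone {n : Type*} [Fintype n] [DecidableEq n] {A D : Matrix n n ℝ}
    (hA : A.PosDef) (hD : D.PosSemidef) (i : n) : (A + D)⁻¹ i i ≤ A⁻¹ i i := by
  have hB : (A + D).PosDef := hA.add_posSemidef hD
  set v : n → ℝ := Pi.single i 1 with hv
  set u := (A + D)⁻¹ *ᵥ v with hu
  set w := A⁻¹ *ᵥ v with hw
  have h1 : (A + D) *ᵥ u = v := by
    rw [hu, mulVec_mulVec, mul_nonsing_inv _ hB.det_pos.ne'.isUnit, one_mulVec]
  have h2 : A *ᵥ w = v := by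
    rw [hw, mulVec_mulVec, mul_nonsing_inv _ hA.det_pos.ne'.isUnit, one_mulVec]
  have e1 : (A + D)⁻¹ i i = v ⬝ᵥ u := by simp [hu, hv]
  have e2 : A⁻¹ i i = v ⬝ᵥ w := by simp [hw, hv]
  have h3 := hA.posSemidef.dotProduct_mulVec_nonneg (w - u)
  have h4 := hD.dotProduct_mulVec_nonneg u
  have hT : Aᵀ = A := by simpa using hA.isHermitian.eq
  have h5 : w ⬝ᵥ (A *ᵥ u) = v ⬝ᵥ u := by
    rw [dotProduct_mulVec, ← mulVec_transpose, hT, h2]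
  have h6 : D *ᵥ u = v - A *ᵥ u := by rw [← h1, add_mulVec]; simp
  rw [h6] at h4
  simp only [star_trivial, mulVec_sub, dotProduct_sub, sub_dotProduct, h2, h5] at h3 h4
  rw [e1, e2]
  have := dotProduct_comm v u
  have := dotProduct_comm v w
  linarith

lemma kf_single_psd {n : Type*} [Fintype n] [DecidableEq n] (i : n) {x : ℝ} (hx : 0 ≤ x) :
    (Matrix.single i i x).PosSemidef := by
  rw [← Matrix.diagonal_single]
  exact Matrix.PosSemidef.diagonal (Pi.single_nonneg.2 hx)

lemma kf_sum_psd {n : Type*} [Fintype n] [DecidableEq n] (x : n → ℝ) (hx : ∀ i, 0 ≤ x i)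
    (s : Finset n) : (∑ i ∈ s, Matrix.single i i (x i)).PosSemidef :=
  Matrix.posSemidef_sum s fun i _ => kf_single_psd i (hx i)

lemma kf_submod {n : Type*} [Fintype n] [DecidableEq n] {P Y : Matrix n n ℝ}
    (hP : P.PosDef) (hY : Y.PosSemidef) (x : n → ℝ) (hx : ∀ i, 0 ≤ x i) (s : Finset n) :
    (P + ∑ i ∈ s, Matrix.single i i (x i) + Y).det * P.det
      ≤ (P + ∑ i ∈ s, Matrix.single i i (x i)).det * (P + Y).det := by
  induction s using Finset.induction_on with
  | empty => simp [mul_comm]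
  | insert i s hi ih =>
    rw [Finset.sum_insert hi, add_comm (Matrix.single i i (x i)), ← add_assoc]
    set Q := P + ∑ i ∈ s, Matrix.single i i (x i) with hQ
    have hQ' : Q.PosDef := hP.add_posSemidef (kf_sum_psd x hx s)
    have hQY : (Q + Y).PosDef := hQ'.add_posSemidef hY
    rw [add_right_comm, kf_det_add_single hQY, kf_det_add_single hQ']
    have h1 := kf_inv_antitone hQ' hY i
    have h2 : 0 ≤ (Q + Y)⁻¹ i i := hQY.inv.posSemidef.diag_nonneg
    have h3 : 1 + x i * (Q + Y)⁻¹ i i ≤ 1 + x i * Q⁻¹ i i := by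
      have := mul_le_mul_of_nonneg_left h1 (hx i)
      linarith
    have h4 : 0 ≤ 1 + x i * (Q + Y)⁻¹ i i := by
      have := mul_nonneg (hx i) h2
      linarith
    have h5 : 0 ≤ Q.det * (P + Y).det :=
      (mul_pos hQ'.det_pos (hP.add_posSemidef hY).det_pos).le
    calc _ = ((Q + Y).det * P.det) * (1 + x i * (Q + Y)⁻¹ i i) := by ring
      _ ≤ (Q.det * (P + Y).det) * (1 + x i * Q⁻¹ i i) := mul_le_mul ih h3 h4 h5
      _ = _ := by ring

lemma kf_mono {n : Type*} [Fintype n] [DecidableEq n] {P : Matrix n n ℝ}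
    (hP : P.PosDef) (x : n → ℝ) (hx : ∀ i, 0 ≤ x i) (s : Finset n) :
    P.det ≤ (P + ∑ i ∈ s, Matrix.single i i (x i)).det := by
  induction s using Finset.induction_on with
  | empty => simp
  | insert i s hi ih =>
    rw [Finset.sum_insert hi, add_comm (Matrix.single i i (x i)), ← add_assoc]
    set Q := P + ∑ i ∈ s, Matrix.single i i (x i) with hQ
    have hQ' : Q.PosDef := hP.add_posSemidef (kf_sum_psd x hx s)
    rw [kf_det_add_single hQ']
    have h2 : 0 ≤ Q⁻¹ i i := hQ'.inv.posSemidef.diag_nonneg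
    refine ih.trans (le_mul_of_one_le_right hQ'.det_pos.le ?_)
    have := mul_nonneg (hx i) h2
    linarith

open Matrix in
lemma kf_one_le_det {n : Type*} [Fintype n] [DecidableEq n] {B : Matrix n n ℝ}
    (hB : B.PosSemidef) : 1 ≤ (1 + B).det := by
  have hA : (1 + B).IsHermitian := (Matrix.PosSemidef.one.add hB).isHermitian
  rw [hA.det_eq_prod_eigenvalues]
  have h : ∀ i, 1 ≤ hA.eigenvalues i := by
    intro i
    have h1 := hA.eigenvalues_eq i
    have h2 := hB.dotProduct_mulVec_nonneg (⇑(hA.eigenvectorBasis i))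
    have h3 : star (⇑(hA.eigenvectorBasis i)) ⬝ᵥ ⇑(hA.eigenvectorBasis i) = 1 := by
      rw [dotProduct_comm, ← EuclideanSpace.inner_eq_star_dotProduct]
      simp [hA.eigenvectorBasis.orthonormal.1 i]
    rw [h1, add_mulVec, one_mulVec, dotProduct_add, h3]
    simpa using h2
  calc (1 : ℝ) = ∏ _i : n, (1 : ℝ) := by simp
    _ ≤ _ := Finset.prod_le_prod (fun _ _ => zero_le_one) (fun i _ => h i)

open Matrix in
lemma kf_dd_psd {n : Type*} [Fintype n] [DecidableEq n] (V : Matrix n n ℝ)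
    (hs : ∀ i j, V i j = V j i) (hV : ∀ i j, 0 ≤ V i j) (c : n → ℝ) (hc : ∀ i, 0 ≤ c i) :
    (Matrix.diagonal (fun i => (∑ j, V i j) + c i) - V).PosSemidef := by
  refine PosSemidef.of_dotProduct_mulVec_nonneg ?_ ?_
  · ext i j
    by_cases h : i = j
    · subst h; simp
    · simp [Matrix.diagonal_apply, h, Ne.symm h, hs i j]
  · intro v
    have e : star v ⬝ᵥ ((Matrix.diagonal (fun i => (∑ j, V i j) + c i) - V) *ᵥ v)
        = (∑ i, ∑ j, V i j * (v i - v j) ^ 2) / 2 + ∑ i, c i * v i ^ 2 := by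
      have s1 : ∑ i, ∑ j, V i j * v j ^ 2 = ∑ i, ∑ j, V i j * v i ^ 2 := by
        rw [Finset.sum_comm]
        exact Finset.sum_congr rfl fun i _ => Finset.sum_congr rfl fun j _ => by rw [hs j i]
      have s2 : ∑ i, ∑ j, V i j * (v i - v j) ^ 2
          = ∑ i, ∑ j, V i j * v i ^ 2 + ∑ i, ∑ j, V i j * v j ^ 2
            - 2 * ∑ i, ∑ j, V i j * (v i * v j) := by
        simp only [Finset.mul_sum, ← Finset.sum_add_distrib, ← Finset.sum_sub_distrib]
        exact Finset.sum_congr rfl fun i _ => Finset.sum_congr rfl fun j _ => by ring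
      rw [s2, s1, sub_mulVec, dotProduct_sub]
      have s3 : star v ⬝ᵥ (Matrix.diagonal (fun i => (∑ j, V i j) + c i) *ᵥ v)
          = ∑ i, ∑ j, V i j * v i ^ 2 + ∑ i, c i * v i ^ 2 := by
        simp only [dotProduct, mulVec_diagonal, ← Finset.sum_mul, ← Finset.sum_add_distrib,
          star_trivial]
        exact Finset.sum_congr rfl fun i _ => by ring
      have s4 : star v ⬝ᵥ (V *ᵥ v) = ∑ i, ∑ j, V i j * (v i * v j) := by
        simp only [dotProduct, mulVec, Finset.mul_sum, star_trivial]
        exact Finset.sum_congr rfl fun i _ => Finset.sum_congr rfl fun j _ => by ring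
      rw [s3, s4]; ring
    rw [e]
    have a1 : 0 ≤ ∑ i, ∑ j, V i j * (v i - v j) ^ 2 :=
      Finset.sum_nonneg fun i _ => Finset.sum_nonneg fun j _ => mul_nonneg (hV i j) (sq_nonneg _)
    have a2 : 0 ≤ ∑ i, c i * v i ^ 2 :=
      Finset.sum_nonneg fun i _ => mul_nonneg (hc i) (sq_nonneg _)
    linarith

/-- The fixed-keyframe selection objective `S ↦ log det L̃(S)` is nonnegative, monotone and
submodular (Lemma 5). -/
theorem fixed_keyframe_logdet_nonneg_monotone_submodular
    (N : ℕ) (hN : 2 ≤ N)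
    (W : Matrix (Fin N) (Fin N) ℝ)
    (hWsymm : W.IsSymm) (hW1 : ∀ i j, i ≠ j → 1 ≤ W i j) (hWdiag : ∀ i, W i i = 0)
    (F : Type*) [Fintype F] [DecidableEq F]
    (U : Fin N → F → ℝ) (hUnonneg : ∀ i m, 0 ≤ U i m) :
    -- the grounded Laplacian for a set `S` of selected fixed keyframes
    let Lloc : Finset F → Matrix (Fin N) (Fin N) ℝ := fun S =>
      Matrix.of fun i j =>
        if i = j then (∑ m ∈ Finset.univ.erase i, W i m) + ∑ m ∈ S, U i m else -W i j
    -- its reduction, deleting the row and column of node 0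
    let Lred : Finset F → Matrix (Fin (N - 1)) (Fin (N - 1)) ℝ := fun S =>
      Matrix.of fun i j =>
        Lloc S ⟨(i : ℕ) + 1, by have := i.isLt; omega⟩ ⟨(j : ℕ) + 1, by have := j.isLt; omega⟩
    let f : Finset F → ℝ := fun S => Real.log (Lred S).det
    -- (i) nonnegative, (ii) monotone, (iii) submodular
    (∀ S : Finset F, 0 ≤ f S)
    ∧ (∀ S T : Finset F, S ⊆ T → f S ≤ f T)
    ∧ (∀ L S : Finset F, f (L ∪ S) + f (L ∩ S) ≤ f L + f S) := by
  obtain ⟨n, rfl⟩ : ∃ n, N = n + 1 := ⟨N - 1, by omega⟩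
  intro Lloc Lred f
  let M : Finset F → Matrix (Fin n) (Fin n) ℝ := Lred
  let V : Matrix (Fin n) (Fin n) ℝ := Matrix.of fun i j => W i.succ j.succ
  let d : Finset F → Fin n → ℝ := fun S i => ∑ m ∈ S, U i.succ m
  let B : Finset F → Matrix (Fin n) (Fin n) ℝ := fun S =>
    Matrix.diagonal (fun i => (∑ j, V i j) + (W i.succ 0 - 1 + d S i)) - V
  have hd : ∀ S i, 0 ≤ d S i := fun S i => Finset.sum_nonneg fun m _ => hUnonneg _ _
  have hB : ∀ S, (B S).PosSemidef := by
    intro S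
    refine kf_dd_psd V (fun i j => hWsymm.apply _ _) ?_ _ ?_
    · intro i j
      by_cases h : i = j
      · subst h; exact (hWdiag _).ge
      · exact zero_le_one.trans (hW1 _ _ (by simpa using h))
    · intro i
      have h1 := hW1 i.succ 0 (Fin.succ_ne_zero i)
      have h2 := hd S i
      linarith
  have hL : ∀ S, M S = 1 + B S := by
    intro S
    ext i j
    change (if i.succ = j.succ then (∑ m ∈ Finset.univ.erase i.succ, W i.succ m)
      + ∑ m ∈ S, U i.succ m else -W i.succ j.succ) = _
    by_cases h : i = j
    · subst h
      have e : ∑ m ∈ Finset.univ.erase i.succ, W i.succ m = W i.succ 0 + ∑ j, V i j := by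
        rw [Finset.sum_erase _ (hWdiag _), Fin.sum_univ_succ]
        rfl
      have e2 : V i i = 0 := hWdiag _
      simp only [if_true, e, Matrix.add_apply, Matrix.one_apply_eq, B, Matrix.sub_apply,
        Matrix.diagonal_apply_eq, e2, d]
      ring
    · have h' : i.succ ≠ j.succ := by simpa using h
      simp [h, B, V]
  have hpd : ∀ S, (M S).PosDef := by
    intro S
    rw [hL]
    exact Matrix.PosDef.one.add_posSemidef (hB S)
  have hdisj : ∀ S T : Finset F, Disjoint S T →
      M (S ∪ T) = M S + ∑ i, Matrix.single i i (d T i) := by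
    intro S T h
    rw [hL, hL, Matrix.sum_single_eq_diagonal, add_assoc]
    congr 1
    have : ∀ i, d (S ∪ T) i = d S i + d T i := fun i => Finset.sum_union h
    ext i j
    by_cases hij : i = j
    · subst hij
      simp only [B, Matrix.add_apply, Matrix.sub_apply, Matrix.diagonal_apply_eq, this]
      ring
    · simp [B, hij]
  refine ⟨fun S => ?_, fun S T h => ?_, fun L S => ?_⟩
  · apply Real.log_nonneg
    change 1 ≤ (M S).det
    rw [hL]
    exact kf_one_le_det (hB S)
  · apply Real.log_le_log (hpd S).det_pos
    change (M S).det ≤ (M T).det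
    have := hdisj S (T \ S) Finset.disjoint_sdiff
    rw [Finset.union_sdiff_of_subset h] at this
    rw [this]
    exact kf_mono (hpd S) _ (hd _) _
  · have dLS : Disjoint (L ∩ S) (L \ S) := (Finset.disjoint_sdiff_inter L S).symm
    have dSL : Disjoint (L ∩ S) (S \ L) := by
      rw [Finset.inter_comm]; exact (Finset.disjoint_sdiff_inter S L).symm
    have e1 := hdisj _ _ dLS
    have e2 := hdisj _ _ dSL
    have e3 := hdisj L (S \ L) Finset.disjoint_sdiff
    have u1 : L ∩ S ∪ L \ S = L := by ext; simp; tauto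
    have u2 : L ∩ S ∪ S \ L = S := by ext; simp; tauto
    have u3 : L ∪ S \ L = L ∪ S := by simp
    rw [u1] at e1
    rw [u2] at e2
    rw [u3, e1] at e3
    have key := kf_submod (hpd (L ∩ S)) (kf_sum_psd (d (S \ L)) (hd _) Finset.univ)
      (d (L \ S)) (hd _) Finset.univ
    rw [← e3, ← e1, ← e2] at key
    change Real.log (M (L ∪ S)).det + Real.log (M (L ∩ S)).det
      ≤ Real.log (M L).det + Real.log (M S).det
    rw [← Real.log_mul (hpd _).det_pos.ne' (hpd _).det_pos.ne',
      ← Real.log_mul (hpd _).det_pos.ne' (hpd _).det_pos.ne']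
    exact Real.log_le_log (mul_pos (hpd _).det_pos (hpd _).det_pos) key
end

section
/- Let A be an n × n real symmetric positive definite matrix and let D₁ and D₂ be n × n real positive semidefinite diagonal matrices. Then det(A + D₁ + D₂) · det(A) ≤ det(A + D₁) · det(A + D₂). -/
open Matrix in
lemma inv_quad_antitone {n : ℕ} (B E : Matrix (Fin n) (Fin n) ℝ) (hB : B.PosDef)
    (hE : E.PosSemidef) (u : Fin n → ℝ) :
    u ⬝ᵥ ((B + E)⁻¹ *ᵥ u) ≤ u ⬝ᵥ (B⁻¹ *ᵥ u) := by
  have hBE : (B + E).PosDef := hB.add_posSemidef hE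
  have hx : (B + E) *ᵥ ((B + E)⁻¹ *ᵥ u) = u := by
    rw [mulVec_mulVec, mul_nonsing_inv _ hBE.det_pos.ne'.isUnit, one_mulVec]
  have hy : B *ᵥ (B⁻¹ *ᵥ u) = u := by
    rw [mulVec_mulVec, mul_nonsing_inv _ hB.det_pos.ne'.isUnit, one_mulVec]
  generalize (B + E)⁻¹ *ᵥ u = x at *
  generalize B⁻¹ *ᵥ u = y at *
  have h1 := hB.posSemidef.dotProduct_mulVec_nonneg (x - y)
  have h2 := hE.dotProduct_mulVec_nonneg x
  have hBt : Bᵀ = B := by simpa using hB.isHermitian.eq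
  have h3 : y ⬝ᵥ (B *ᵥ x) = u ⬝ᵥ x := by
    rw [dotProduct_mulVec, ← mulVec_transpose, hBt, hy]
  have h4 : x ⬝ᵥ (B *ᵥ x) + x ⬝ᵥ (E *ᵥ x) = u ⬝ᵥ x := by
    rw [← dotProduct_add, ← add_mulVec, hx, dotProduct_comm]
  simp only [star_trivial, mulVec_sub, hy, dotProduct_sub, sub_dotProduct, h3] at h1 h2
  rw [dotProduct_comm x u, dotProduct_comm y u] at h1
  linarith

open Matrix in
lemma det_add_rank_one {n : ℕ} (B : Matrix (Fin n) (Fin n) ℝ) (hB : B.PosDef)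
    (u : Fin n → ℝ) :
    (B + vecMulVec u u).det = B.det * (1 + u ⬝ᵥ (B⁻¹ *ᵥ u)) := by
  rw [vecMulVec_eq Unit, det_add_replicateCol_mul_replicateRow hB.det_pos.ne'.isUnit,
    Matrix.mul_assoc, ← replicateCol_mulVec]
  congr 1
  simp [Matrix.det_unique, Matrix.mul_apply, dotProduct]

open Matrix in
lemma det_add_sum_aux {n : ℕ} (A D : Matrix (Fin n) (Fin n) ℝ) (hA : A.PosDef)
    (hD : D.PosSemidef) (v : Fin n → Fin n → ℝ) (s : Finset (Fin n)) :
    (∑ i ∈ s, vecMulVec (v i) (v i)).PosSemidef ∧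
    (A + D + ∑ i ∈ s, vecMulVec (v i) (v i)).det * A.det ≤
      (A + D).det * (A + ∑ i ∈ s, vecMulVec (v i) (v i)).det := by
  induction s using Finset.induction_on with
  | empty => simpa using PosSemidef.zero
  | insert a s ha ih =>
    rw [Finset.sum_insert ha]
    obtain ⟨hP, ih⟩ := ih
    generalize (∑ i ∈ s, vecMulVec (v i) (v i)) = P at *
    have hv : (vecMulVec (v a) (v a)).PosSemidef := by
      simpa using posSemidef_vecMulVec_self_star (v a)
    refine ⟨hv.add hP, ?_⟩
    have hAP := hA.add_posSemidef hP
    have hAPD := hAP.add_posSemidef hD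
    have hAD := hA.add_posSemidef hD
    have e1 : A + D + (vecMulVec (v a) (v a) + P) = A + P + D + vecMulVec (v a) (v a) := by abel
    have e2 : A + (vecMulVec (v a) (v a) + P) = A + P + vecMulVec (v a) (v a) := by abel
    have e3 : A + D + P = A + P + D := by abel
    rw [e1, e2, det_add_rank_one _ hAPD, det_add_rank_one _ hAP]
    rw [e3] at ih
    have hq := inv_quad_antitone _ _ hAP hD (v a)
    have hq0 := hAPD.inv.posSemidef.dotProduct_mulVec_nonneg (v a)
    rw [star_trivial] at hq0
    calc _ = ((A + P + D).det * A.det) * (1 + v a ⬝ᵥ ((A + P + D)⁻¹ *ᵥ v a)) := by ring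
      _ ≤ ((A + D).det * (A + P).det) * (1 + v a ⬝ᵥ ((A + P)⁻¹ *ᵥ v a)) := by
        apply mul_le_mul ih (by linarith) (by linarith)
        exact (mul_pos hAD.det_pos hAP.det_pos).le
      _ = _ := by ring

/-- The determinant inequality behind the submodularity of the log-determinant objective:
for a symmetric positive definite `A` and positive semidefinite diagonal `D₁`, `D₂`,
`det(A + D₁ + D₂) · det A ≤ det(A + D₁) · det(A + D₂)`. -/
theorem det_add_psd_diag_submodular
    (n : ℕ) (A D1 D2 : Matrix (Fin n) (Fin n) ℝ)
    (hA : A.PosDef) (hAsymm : A.IsSymm)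
    (hD1 : D1.PosSemidef) (hD1diag : D1.IsDiag)
    (hD2 : D2.PosSemidef) (hD2diag : D2.IsDiag) :
    (A + D1 + D2).det * A.det ≤ (A + D1).det * (A + D2).det := by
  have h := (det_add_sum_aux A D1 hA hD1
    (fun i => Pi.single i (Real.sqrt (D2 i i))) Finset.univ).2
  have e : ∑ i, Matrix.vecMulVec (Pi.single i (Real.sqrt (D2 i i)))
      (Pi.single i (Real.sqrt (D2 i i))) = D2 := by
    ext j k
    simp only [Matrix.sum_apply, Matrix.vecMulVec_apply, Pi.single_apply]
    by_cases hjk : j = k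
    · subst hjk
      simp [Real.mul_self_sqrt (hD2.diag_nonneg (i := j))]
    · rw [hD2diag hjk]
      apply Finset.sum_eq_zero
      intro i _
      by_cases h1 : j = i
      · have : k ≠ i := fun h => hjk (h1.trans h.symm)
        simp [this]
      · simp [h1]
  rwa [e] at h
end
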